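/- arXiv:2109.15061 — 2 statements merged into one kernel-verified Lean document; each statement's English description precedes it below -/
import Mathlib

section
/- Let X be a bounded metric space and let p ∈ [1,∞]. For any two Radon probability measures α, β on X, |rad_p(α) − rad_p(β)| ≤ d_{W,p}(α,β); that is, rad_p is 1-Lipschitz with respect to the p-Wasserstein distance. -/
open MeasureTheory ENNReal NNReal

noncomputable section

namespace Paper

variable {X Y : Type*}

/-- The (topological) support of a measure: points all of whose open neighborhoods
have positive measure. -/
def msupport [TopologicalSpace X] [MeasurableSpace X] (α : Measure X) : Set X :=
  {x | ∀ U : Set X, IsOpen U → x ∈ U → 0 < α U}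

/-- The `p`-diameter of a measure, `p ∈ [1,∞]`.  For `p = ∞` it is the diameter of the
support; for finite `p` it is `(∬ d(x,x')^p dα dα)^{1/p}`. -/
def pDiam [PseudoEMetricSpace X] [MeasurableSpace X] (p : ℝ≥0∞) (α : Measure X) : ℝ≥0∞ :=
  if p = ∞ then EMetric.diam (msupport α)
  else (∫⁻ x, ∫⁻ y, edist x y ^ p.toReal ∂α ∂α) ^ (1 / p.toReal)

/-- The `p`-radius of a measure, `p ∈ [1,∞]`.  For `p = ∞` it is the radius of the
support; for finite `p` it is `inf_x (∫ d(x,x')^p dα)^{1/p}`. -/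
def pRad [PseudoEMetricSpace X] [MeasurableSpace X] (p : ℝ≥0∞) (α : Measure X) : ℝ≥0∞ :=
  if p = ∞ then ⨅ x : X, ⨆ a ∈ msupport α, edist x a
  else ⨅ x : X, (∫⁻ y, edist x y ^ p.toReal ∂α) ^ (1 / p.toReal)

/-- Couplings between two measures: measures on the product with the given marginals. -/
def Coupling [MeasurableSpace X] (α β : Measure X) : Set (Measure (X × X)) :=
  {μ | μ.map Prod.fst = α ∧ μ.map Prod.snd = β}

/-- The `q`-Wasserstein distance, `q ∈ [1,∞]`. -/
def wDist [PseudoEMetricSpace X] [MeasurableSpace X] (q : ℝ≥0∞) (α β : Measure X) : ℝ≥0∞ :=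
  if q = ∞ then ⨅ μ ∈ Coupling α β, ⨆ z ∈ msupport μ, edist z.1 z.2
  else ⨅ μ ∈ Coupling α β, (∫⁻ z, edist z.1 z.2 ^ q.toReal ∂μ) ^ (1 / q.toReal)

/-- The distortion `sup |d(x,x') - d(f x, f x')|` of a map between (pseudo e)metric spaces. -/
def distortion [PseudoEMetricSpace X] [PseudoEMetricSpace Y] (f : X → Y) : ℝ≥0∞ :=
  ⨆ x : X, ⨆ x' : X,
    max (edist x x' - edist (f x) (f x')) (edist (f x) (f x') - edist x x')

/-- The codistortion `sup_{x,y} |d_X(x, ψ y) - d_Y(φ x, y)|` of a pair of maps. -/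
def codistortion [PseudoEMetricSpace X] [PseudoEMetricSpace Y] (φ : X → Y) (ψ : Y → X) :
    ℝ≥0∞ :=
  ⨆ x : X, ⨆ y : Y,
    max (edist x (ψ y) - edist (φ x) y) (edist (φ x) y - edist x (ψ y))

/-- Gromov--Hausdorff distance, via the distortion/codistortion formula. -/
def ghDist (X Y : Type*) [PseudoEMetricSpace X] [PseudoEMetricSpace Y] : ℝ≥0∞ :=
  (1 / 2 : ℝ≥0∞) *
    ⨅ φ : X → Y, ⨅ ψ : Y → X,
      max (distortion φ) (max (distortion ψ) (codistortion φ ψ))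

/-- The invariant `i_{q,p}(α) = (∫ d_{W,q}(α, δ_x)^p dα(x))^{1/p}`. -/
def iInv [PseudoEMetricSpace X] [MeasurableSpace X] (q p : ℝ≥0∞) (α : Measure X) : ℝ≥0∞ :=
  if p = ∞ then ⨆ x ∈ msupport α, wDist q α (Measure.dirac x)
  else (∫⁻ x, wDist q α (Measure.dirac x) ^ p.toReal ∂α) ^ (1 / p.toReal)

/-- Dirac delta as a probability measure. -/
def diracPM [MeasurableSpace X] (x : X) : ProbabilityMeasure X :=
  ⟨Measure.dirac x, inferInstance⟩

/-- Finitely supported probability measures. -/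
def finPM (X : Type*) [TopologicalSpace X] [MeasurableSpace X] : Set (ProbabilityMeasure X) :=
  {α | (msupport α.toMeasure).Finite}

/-- The `p`-Vietoris--Rips metric thickening at scale `r`, as a subset of the space of
probability measures with the weak topology. -/
def VRm (p : ℝ≥0∞) (X : Type*) [PseudoEMetricSpace X] [MeasurableSpace X] (r : ℝ≥0∞) :
    Set (ProbabilityMeasure X) :=
  {α | pDiam p α.toMeasure < r}

/-- The `p`-Čech metric thickening at scale `r`. -/
def Cechm (p : ℝ≥0∞) (X : Type*) [PseudoEMetricSpace X] [MeasurableSpace X] (r : ℝ≥0∞) :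
    Set (ProbabilityMeasure X) :=
  {α | pRad p α.toMeasure < r}

/-- Finitely supported version of the `p`-Vietoris--Rips thickening. -/
def VRmFin (p : ℝ≥0∞) (X : Type*) [PseudoEMetricSpace X] [MeasurableSpace X] (r : ℝ≥0∞) :
    Set (ProbabilityMeasure X) :=
  VRm p X r ∩ finPM X

/-- Finitely supported version of the `p`-Čech thickening. -/
def CechmFin (p : ℝ≥0∞) (X : Type*) [PseudoEMetricSpace X] [MeasurableSpace X] (r : ℝ≥0∞) :
    Set (ProbabilityMeasure X) :=
  Cechm p X r ∩ finPM X


/-- Convex combination `(1-t)·α + t·β` of probability measures. -/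
def lincomb [MeasurableSpace X] (t : ℝ) (h0 : 0 ≤ t) (h1 : t ≤ 1)
    (α β : ProbabilityMeasure X) : ProbabilityMeasure X :=
  ⟨ENNReal.ofReal (1 - t) • α.toMeasure + ENNReal.ofReal t • β.toMeasure, by
    constructor
    simp only [Measure.coe_add, Pi.add_apply, Measure.smul_apply, smul_eq_mul,
      measure_univ, mul_one]
    rw [← ENNReal.ofReal_add (by linarith) h0]
    norm_num⟩

/-- A `δ`-map between spaces-with-functions. -/
def IsDeltaMap {A B : Type*} [TopologicalSpace A] [TopologicalSpace B]
    (φA : A → ℝ) (φB : B → ℝ) (δ : ℝ) (F : A → B) : Prop :=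
  Continuous F ∧ ∀ a, φB (F a) ≤ φA a + δ

/-- `δ`-homotopy between two `δ`-maps. -/
def DeltaHomotopic {A B : Type*} [TopologicalSpace A] [TopologicalSpace B]
    (φA : A → ℝ) (φB : B → ℝ) (δ : ℝ) (F₀ F₁ : A → B) : Prop :=
  ∃ H : A × unitInterval → B, Continuous H ∧
    (∀ a, H (a, 0) = F₀ a) ∧ (∀ a, H (a, 1) = F₁ a) ∧
    ∀ t : unitInterval, IsDeltaMap φA φB δ (fun a => H (a, t))

/-- `δ`-homotopy equivalence between two spaces-with-functions. -/
def DeltaHomotopyEquiv {A B : Type*} [TopologicalSpace A] [TopologicalSpace B]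
    (δ : ℝ) (φA : A → ℝ) (φB : B → ℝ) : Prop :=
  ∃ F : A → B, ∃ G : B → A,
    IsDeltaMap φA φB δ F ∧ IsDeltaMap φB φA δ G ∧
    DeltaHomotopic φA φA (2 * δ) (G ∘ F) id ∧
    DeltaHomotopic φB φB (2 * δ) (F ∘ G) id

/-- The homotopy type distance `d_HT`. -/
def dHT {A B : Type*} [TopologicalSpace A] [TopologicalSpace B]
    (φA : A → ℝ) (φB : B → ℝ) : ℝ≥0∞ :=
  sInf {e : ℝ≥0∞ | ∃ δ : ℝ, 0 ≤ δ ∧ DeltaHomotopyEquiv δ φA φB ∧ e = ENNReal.ofReal δ}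

/-- The `p`-spread of a metric space. -/
def pSpread (p : ℝ≥0∞) (X : Type*) [PseudoEMetricSpace X] [MeasurableSpace X] : ℝ≥0∞ :=
  ⨅ αs ∈ finPM X, ⨆ α : ProbabilityMeasure X,
    wDist p (αs : ProbabilityMeasure X).toMeasure α.toMeasure

/-- The medial axis of a subset `X` of a normed space. -/
def medialAxis {E : Type*} [NormedAddCommGroup E] (X : Set E) : Set E :=
  closure {y | ∃ x₁ ∈ X, ∃ x₂ ∈ X, x₁ ≠ x₂ ∧
    dist y x₁ = Metric.infDist y X ∧ dist y x₂ = Metric.infDist y X}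

/-- The reach of a subset `X`: the distance from `X` to its medial axis. -/
def reach {E : Type*} [NormedAddCommGroup E] (X : Set E) : ℝ≥0∞ :=
  ⨅ x ∈ X, ⨅ y ∈ medialAxis X, edist x y

/-- `p`-radius with the infimum restricted to a subset `X` of the ambient space. -/
def pRadIn {E : Type*} [PseudoEMetricSpace E] [MeasurableSpace E] (p : ℝ≥0∞)
    (X : Set E) (α : Measure E) : ℝ≥0∞ :=
  ⨅ x ∈ X, (∫⁻ y, edist x y ^ p.toReal ∂α) ^ (1 / p.toReal)


open TopologicalSpace Filter in
/-- An inner regular finite measure is concentrated on a separable set. -/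
theorem exists_isSeparable_ae_mem [PseudoMetricSpace X] [MeasurableSpace X]
    [OpensMeasurableSpace X] (α : Measure X) [IsFiniteMeasure α] [α.InnerRegular] :
    ∃ t : Set X, IsSeparable t ∧ ∀ᵐ x ∂α, x ∈ t := by
  have h (n : ℕ) : ∃ K : Set X, IsCompact K ∧ α Set.univ < α K + (n + 1 : ℝ≥0∞)⁻¹ := by
    obtain ⟨K, -, hK, hαK⟩ := MeasurableSet.univ.exists_isCompact_lt_add (μ := α)
      (measure_ne_top α _) (ε := (n + 1 : ℝ≥0∞)⁻¹) (by simp)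
    exact ⟨K, hK, hαK⟩
  choose K hK hαK using h
  refine ⟨closure (⋃ n, K n), (IsSeparable.iUnion fun n ↦ (hK n).isSeparable).closure, ?_⟩
  change α (closure (⋃ n, K n))ᶜ = 0
  refine le_antisymm (ge_of_tendsto' (ENNReal.tendsto_inv_nat_nhds_zero.comp
    (tendsto_add_atTop_nat 1)) fun n ↦ ?_) zero_le
  have hsub : α (K n) ≤ α (closure (⋃ n, K n)) :=
    measure_mono ((Set.subset_iUnion K n).trans subset_closure)
  have hadd := measure_add_measure_compl (μ := α) (isClosed_closure (s := ⋃ n, K n)).measurableSet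
  have hlt := (hαK n).le.trans (add_le_add_left hsub _)
  rw [← hadd] at hlt
  simpa using (ENNReal.add_le_add_iff_left (measure_ne_top α _)).1 hlt

open TopologicalSpace in
/-- A measure concentrated on a separable set is concentrated on its support. -/
theorem ae_mem_msupport [PseudoMetricSpace X] [MeasurableSpace X] (α : Measure X) {t : Set X}
    (ht : IsSeparable t) (hα : ∀ᵐ x ∂α, x ∈ t) : ∀ᵐ x ∂α, x ∈ msupport α := by
  have hsep : IsSeparable (t \ msupport α) := ht.mono Set.sdiff_subset
  have := hsep.secondCountableTopology
  have hnull : α (t \ msupport α) = 0 := by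
    refine IsLindelof.induction_on (p := fun s ↦ α s = 0) IsLindelof.of_coe
      (fun s u hsu hu ↦ measure_mono_null hsu hu)
      (fun S hS h ↦ (measure_sUnion_null_iff hS).2 h) fun x hx ↦ ?_
    have hx' : ∃ U : Set X, IsOpen U ∧ x ∈ U ∧ α U = 0 := by
      simpa [msupport] using hx.2
    obtain ⟨U, hU, hxU, hαU⟩ := hx'
    exact ⟨U, mem_nhdsWithin_of_mem_nhds (hU.mem_nhds hxU), hαU⟩
  filter_upwards [hα, measure_eq_zero_iff_ae_notMem.1 hnull] with x hx hx'
  by_contra h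
  exact hx' ⟨hx, h⟩

/-- A continuous measure preserving map sends the support into the support. -/
theorem map_mem_msupport [TopologicalSpace X] [MeasurableSpace X] [TopologicalSpace Y]
    [MeasurableSpace Y] [OpensMeasurableSpace Y] {μ : Measure X} {ν : Measure Y} {f : X → Y}
    (hf : Continuous f) (hμ : MeasurePreserving f μ ν) {x : X} (hx : x ∈ msupport μ) :
    f x ∈ msupport ν := fun U hU hxU ↦ by
  rw [← hμ.measure_preimage hU.measurableSet.nullMeasurableSet]
  exact hx _ (hU.preimage hf) hxU

namespace Coupling

theorem measurePreserving_fst [MeasurableSpace X] {α β : Measure X} {μ : Measure (X × X)}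
    (hμ : μ ∈ Coupling α β) : MeasurePreserving Prod.fst μ α :=
  ⟨measurable_fst, hμ.1⟩

theorem measurePreserving_snd [MeasurableSpace X] {α β : Measure X} {μ : Measure (X × X)}
    (hμ : μ ∈ Coupling α β) : MeasurePreserving Prod.snd μ β :=
  ⟨measurable_snd, hμ.2⟩

theorem map_swap_mem [MeasurableSpace X] {α β : Measure X} {μ : Measure (X × X)}
    (hμ : μ ∈ Coupling α β) : μ.map Prod.swap ∈ Coupling β α :=
  ⟨(Measure.map_map measurable_fst measurable_swap).trans hμ.2,
    (Measure.map_map measurable_snd measurable_swap).trans hμ.1⟩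

end Coupling

theorem mem_msupport_of_mem_msupport_map_swap [TopologicalSpace X] [MeasurableSpace X]
    {μ : Measure (X × X)} {z : X × X} (hz : z ∈ msupport (μ.map Prod.swap)) :
    z.swap ∈ msupport μ := fun U hU hzU ↦ by
  have h := hz (Prod.swap ⁻¹' U) (hU.preimage continuous_swap) hzU
  rw [show (Prod.swap : X × X → X × X) = MeasurableEquiv.prodComm from rfl,
    MeasurableEquiv.map_apply] at h
  exact h

theorem wDist_le_wDist_swap [PseudoEMetricSpace X] [MeasurableSpace X] (p : ℝ≥0∞)
    (α β : Measure X) : wDist p β α ≤ wDist p α β := by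
  unfold wDist
  split_ifs
  · refine le_iInf₂ fun μ hμ ↦ iInf₂_le_of_le _ (Coupling.map_swap_mem hμ)
      (iSup₂_le fun z hz ↦ ?_)
    rw [edist_comm]
    exact le_iSup₂_of_le z.swap (mem_msupport_of_mem_msupport_map_swap hz) le_rfl
  · refine le_iInf₂ fun μ hμ ↦ iInf₂_le_of_le _ (Coupling.map_swap_mem hμ) (le_of_eq ?_)
    rw [show (Prod.swap : X × X → X × X) = MeasurableEquiv.prodComm from rfl, lintegral_map_equiv]
    simp [MeasurableEquiv.prodComm, edist_comm]

theorem wDist_comm [PseudoEMetricSpace X] [MeasurableSpace X] (p : ℝ≥0∞) (α β : Measure X) :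
    wDist p α β = wDist p β α :=
  le_antisymm (wDist_le_wDist_swap p β α) (wDist_le_wDist_swap p α β)

theorem pRad_le_pRad_add_wDist [PseudoMetricSpace X] [MeasurableSpace X] [BorelSpace X]
    {p : ℝ≥0∞} (hp : 1 ≤ p) (α β : Measure X) [IsFiniteMeasure α] [IsFiniteMeasure β]
    [α.InnerRegular] [β.InnerRegular] : pRad p α ≤ pRad p β + wDist p α β := by
  obtain ⟨s, hs, hαs⟩ := exists_isSeparable_ae_mem α
  obtain ⟨t, ht, hβt⟩ := exists_isSeparable_ae_mem β
  unfold pRad wDist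
  split_ifs with hp_top
  · simp_rw [ENNReal.iInf_add, ENNReal.add_iInf]
    refine le_iInf fun x ↦ le_iInf₂ fun μ hμ ↦ iInf_le_of_le x (iSup₂_le fun a ha ↦ ?_)
    have hfst := Coupling.measurePreserving_fst hμ
    have hsnd := Coupling.measurePreserving_snd hμ
    have hμst : ∀ᵐ z ∂μ, z ∈ s ×ˢ t := by
      filter_upwards [hfst.quasiMeasurePreserving.ae hαs,
        hsnd.quasiMeasurePreserving.ae hβt] with z hz hz' using ⟨hz, hz'⟩
    refine ENNReal.le_of_forall_pos_le_add fun ε hε _ ↦ ?_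
    have hball : μ (Prod.fst ⁻¹' Metric.eball a ε) ≠ 0 := by
      rw [hfst.measure_preimage Metric.isOpen_eball.measurableSet.nullMeasurableSet]
      exact (ha _ Metric.isOpen_eball (Metric.mem_eball_self (by simpa using hε))).ne'
    obtain ⟨z, hza, hz⟩ := ((frequently_ae_mem_iff.2 hball).and_eventually
      (ae_mem_msupport μ (hs.prod ht) hμst)).exists
    calc edist x a ≤ edist x z.2 + edist z.2 z.1 + edist z.1 a := edist_triangle4 _ _ _ _
      _ ≤ _ := by
        rw [edist_comm z.2]
        gcongr
        · exact le_iSup₂_of_le (f := fun b (_ : b ∈ msupport β) ↦ edist x b) z.2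
            (map_mem_msupport continuous_snd hsnd hz) le_rfl
        · exact le_iSup₂_of_le (f := fun z (_ : z ∈ msupport μ) ↦ edist z.1 z.2) z hz le_rfl
        · exact (Metric.mem_eball.1 hza).le
  · simp_rw [ENNReal.iInf_add, ENNReal.add_iInf]
    refine le_iInf fun x ↦ le_iInf₂ fun μ hμ ↦ iInf_le_of_le x ?_
    have hfst := Coupling.measurePreserving_fst hμ
    have hsnd := Coupling.measurePreserving_snd hμ
    have hp' : 1 ≤ p.toReal := by
      simpa using ENNReal.toReal_mono hp_top hp
    have hα : AEStronglyMeasurable id α :=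
      aestronglyMeasurable_iff_aemeasurable_separable.2 ⟨aemeasurable_id, s, hs, hαs⟩
    have hβ : AEStronglyMeasurable id β :=
      aestronglyMeasurable_iff_aemeasurable_separable.2 ⟨aemeasurable_id, t, ht, hβt⟩
    have hdist : AEMeasurable (fun z : X × X ↦ edist z.1 z.2) μ :=
      (hα.comp_measurePreserving hfst).edist (hβ.comp_measurePreserving hsnd)
    have hx : Measurable (fun y ↦ edist x y) := measurable_edist_right
    have hint (ν : Measure X) (f : X × X → X) (hf : MeasurePreserving f μ ν) :
        ∫⁻ y, edist x y ^ p.toReal ∂ν = ∫⁻ z, edist x (f z) ^ p.toReal ∂μ :=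
      (hf.lintegral_comp (hx.pow_const _)).symm
    rw [hint α _ hfst, hint β _ hsnd]
    refine le_trans ?_ (ENNReal.lintegral_Lp_add_le (hx.comp measurable_snd).aemeasurable
      hdist hp')
    gcongr with z
    rw [Pi.add_apply, edist_comm z.1]
    exact edist_triangle _ _ _

/-- For a bounded metric space `X`, `p ∈ [1,∞]`, and Radon probability
measures `α, β` on `X`: `|rad_p(α) − rad_p(β)| ≤ d_{W,p}(α,β)`, expressed as the
corresponding pair of one-sided inequalities in `ℝ≥0∞`. -/
theorem pRad_lipschitz_wDist {X : Type*} [MetricSpace X] [MeasurableSpace X] [BorelSpace X]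
    [BoundedSpace X] (p : ℝ≥0∞) (hp : 1 ≤ p)
    (α β : Measure X) [IsProbabilityMeasure α] [IsProbabilityMeasure β]
    (hα : α.InnerRegular) (hβ : β.InnerRegular) :
    pRad p α ≤ pRad p β + wDist p α β ∧ pRad p β ≤ pRad p α + wDist p α β := by
  exact ⟨pRad_le_pRad_add_wDist hp α β,
    wDist_comm p α β ▸ pRad_le_pRad_add_wDist hp β α⟩

end Paper
end
end

section
/- Let X and Y be totally bounded metric spaces and let p ∈ [1,∞]. Then d_HT((𝒫_X, diam_p^X), (𝒫_Y, diam_p^Y)) ≤ 2·d_GH(X,Y) and d_HT((𝒫_X, rad_p^X), (𝒫_Y, rad_p^Y)) ≤ 2·d_GH(X,Y); the same bounds hold with 𝒫_X, 𝒫_Y replaced by the spaces 𝒫^fin_X, 𝒫^fin_Y of finitely supported measures. -/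
open MeasureTheory ENNReal NNReal

noncomputable section

namespace Paper

variable {X Y : Type*}

section Support

variable {X : Type*} [TopologicalSpace X] [MeasurableSpace X]

lemma msupport_eq_support (α : Measure X) : msupport α = α.support := by
  ext x
  rw [Measure.mem_support_iff_forall]
  refine ⟨fun h U hU => ?_, fun h U hU hx => h U (hU.mem_nhds hx)⟩
  obtain ⟨V, hVU, hV, hx⟩ := mem_nhds_iff.1 hU
  exact (h V hV hx).trans_le (measure_mono hVU)

lemma ae_mem_msupport_s12 [SecondCountableTopology X] (α : Measure X) :
    ∀ᵐ x ∂α, x ∈ msupport α := by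
  rw [msupport_eq_support]
  exact Measure.support_mem_ae

lemma msupport_smul_add_subset (a b : ℝ≥0∞) (α β : Measure X) :
    msupport (a • α + b • β) ⊆ msupport α ∪ msupport β := by
  intro x hx
  by_contra hcon
  simp only [msupport, Set.mem_union, Set.mem_ofPred_eq, not_or, not_forall, not_lt,
    nonpos_iff_eq_zero] at hcon
  obtain ⟨⟨U, hU, hxU, hU0⟩, V, hV, hxV, hV0⟩ := hcon
  have h := hx (U ∩ V) (hU.inter hV) ⟨hxU, hxV⟩
  have h1 : α (U ∩ V) = 0 := measure_mono_null Set.inter_subset_left hU0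
  have h2 : β (U ∩ V) = 0 := measure_mono_null Set.inter_subset_right hV0
  simp [h1, h2] at h

end Support

/-- `α` and `β` admit a coupling concentrated on the relation `R`. -/
def IsCoupledBy [MeasurableSpace X] [MeasurableSpace Y] (α : Measure X) (β : Measure Y)
    (R : X → Y → Prop) : Prop :=
  ∃ μ : Measure (X × Y), μ.map Prod.fst = α ∧ μ.map Prod.snd = β ∧ ∀ᵐ z ∂μ, R z.1 z.2

lemma isProbabilityMeasure_of_map [MeasurableSpace X] [MeasurableSpace Y]
    {μ : Measure (X × Y)} [h : IsProbabilityMeasure (μ.map Prod.fst)] : IsProbabilityMeasure μ := by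
  refine ⟨?_⟩
  have := h.measure_univ
  rwa [Measure.map_apply measurable_fst MeasurableSet.univ, Set.preimage_univ] at this

lemma lintegral_rpow_add_const_le {Ω : Type*} [MeasurableSpace Ω] (μ : Measure Ω)
    [IsProbabilityMeasure μ] {f : Ω → ℝ≥0∞} (hf : Measurable f) {q : ℝ} (hq : 1 ≤ q)
    (C : ℝ≥0∞) :
    (∫⁻ x, (f x + C) ^ q ∂μ) ^ (1 / q) ≤ (∫⁻ x, f x ^ q ∂μ) ^ (1 / q) + C := by
  have h := ENNReal.lintegral_Lp_add_le (μ := μ) hf.aemeasurable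
    (measurable_const (a := C)).aemeasurable hq
  have hq0 : q ≠ 0 := by positivity
  simpa [← ENNReal.rpow_mul, hq0] using h

lemma IsCoupledBy.exists_near [TopologicalSpace X] [SecondCountableTopology X]
    [MeasurableSpace X] [PseudoEMetricSpace Y] [MeasurableSpace Y] [OpensMeasurableSpace Y]
    {α : Measure X} {β : Measure Y} {R : X → Y → Prop}
    (h : IsCoupledBy α β R) {b : Y} (hb : b ∈ msupport β) {ε : ℝ≥0∞} (hε : 0 < ε) :
    ∃ x ∈ msupport α, ∃ y, R x y ∧ edist y b < ε := by
  obtain ⟨μ, rfl, rfl, hR⟩ := h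
  have hpos := hb (Metric.eball b ε) Metric.isOpen_eball (Metric.mem_eball_self hε)
  rw [Measure.map_apply measurable_snd Metric.isOpen_eball.measurableSet] at hpos
  have h1 := ae_of_ae_map measurable_fst.aemeasurable (ae_mem_msupport_s12 (μ.map Prod.fst))
  obtain ⟨z, hz, hzR, hzs⟩ := ((frequently_ae_iff.2 hpos.ne').and_eventually (hR.and h1)).exists
  exact ⟨z.1, hzs, z.2, hzR, hz⟩

section Comparison

variable [MetricSpace X] [MeasurableSpace X] [BorelSpace X] [SecondCountableTopology X]
  [MetricSpace Y] [MeasurableSpace Y] [BorelSpace Y]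

lemma lintegral_edist_rpow_map {Ω : Type*} [MeasurableSpace Ω] (μ : Measure Ω)
    [IsProbabilityMeasure μ] {u : Ω → X} (hu : Measurable u) (q : ℝ) :
    ∫⁻ x, ∫⁻ y, edist x y ^ q ∂(μ.map u) ∂(μ.map u)
      = ∫⁻ z, ∫⁻ w, edist (u z) (u w) ^ q ∂μ ∂μ := by
  have := Measure.isProbabilityMeasure_map (μ := μ) hu.aemeasurable
  have hm : Measurable fun x : X × X => edist x.1 x.2 ^ q := by fun_prop
  rw [lintegral_map (hm.lintegral_prod_right' (ν := μ.map u)) hu]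
  refine lintegral_congr fun z => ?_
  exact lintegral_map (hm.comp measurable_prodMk_left) hu

lemma IsCoupledBy.pDiam_le [SecondCountableTopology Y] {α : Measure X} {β : Measure Y}
    [IsProbabilityMeasure α] {R : X → Y → Prop} (h : IsCoupledBy α β R) {p : ℝ≥0∞} (hp : 1 ≤ p) {C : ℝ≥0∞}
    (hC : ∀ x y x' y', R x y → R x' y' → edist y y' ≤ edist x x' + C) :
    pDiam p β ≤ pDiam p α + C := by
  unfold pDiam
  split_ifs with hp'
  · refine Metric.ediam_le fun b hb b' hb' => ?_
    refine ENNReal.le_of_forall_pos_le_add fun ε hε _ => ?_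
    have hε2 : (0 : ℝ≥0∞) < ε / 2 := by simpa using hε.ne'
    obtain ⟨x, hx, y, hxy, hy⟩ := h.exists_near hb hε2
    obtain ⟨x', hx', y', hxy', hy'⟩ := h.exists_near hb' hε2
    calc edist b b' ≤ edist b y + edist y y' + edist y' b' := edist_triangle4 _ _ _ _
      _ ≤ ε / 2 + (Metric.ediam (msupport α) + C) + ε / 2 := by
        gcongr
        · rw [edist_comm]; exact hy.le
        · refine (hC _ _ _ _ hxy hxy').trans ?_
          gcongr
          exact Metric.edist_le_ediam_of_mem hx hx'
      _ = Metric.ediam (msupport α) + C + (ε / 2 + ε / 2) := by ring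
      _ = _ := by rw [ENNReal.add_halves]; rfl
  · obtain ⟨μ, rfl, rfl, hR⟩ := h
    have : IsProbabilityMeasure μ := isProbabilityMeasure_of_map
    have hq : 1 ≤ p.toReal := by
      simpa using ENNReal.toReal_mono hp' hp
    rw [lintegral_edist_rpow_map μ measurable_fst, lintegral_edist_rpow_map μ measurable_snd]
    have hm : Measurable fun z : (X × Y) × (X × Y) => edist z.1.1 z.2.1 := by fun_prop
    calc (∫⁻ z, ∫⁻ w, edist z.2 w.2 ^ p.toReal ∂μ ∂μ) ^ (1 / p.toReal)
        ≤ (∫⁻ z, ∫⁻ w, (edist z.1 w.1 + C) ^ p.toReal ∂μ ∂μ) ^ (1 / p.toReal) := by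
          gcongr ?_ ^ _
          refine lintegral_mono_ae ?_
          filter_upwards [hR] with z hz
          refine lintegral_mono_ae ?_
          filter_upwards [hR] with w hw
          gcongr
          exact hC _ _ _ _ hz hw
      _ = (∫⁻ q, (edist q.1.1 q.2.1 + C) ^ p.toReal ∂(μ.prod μ)) ^ (1 / p.toReal) := by
          rw [lintegral_prod _ (by fun_prop)]
      _ ≤ (∫⁻ q, edist q.1.1 q.2.1 ^ p.toReal ∂(μ.prod μ)) ^ (1 / p.toReal) + C :=
          lintegral_rpow_add_const_le _ hm hq C
      _ = _ := by rw [lintegral_prod _ (by fun_prop)]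

lemma IsCoupledBy.pRad_le {α : Measure X} {β : Measure Y} [IsProbabilityMeasure α]
    {R : X → Y → Prop} (h : IsCoupledBy α β R) {p : ℝ≥0∞} (hp : 1 ≤ p) {C : ℝ≥0∞}
    (hC : ∀ x₀, ∃ y₀, ∀ x y, R x y → edist y₀ y ≤ edist x₀ x + C) :
    pRad p β ≤ pRad p α + C := by
  unfold pRad
  split_ifs with hp'
  · rw [ENNReal.iInf_add]
    refine le_iInf fun x₀ => ?_
    obtain ⟨y₀, hy₀⟩ := hC x₀
    refine (iInf_le _ y₀).trans (iSup₂_le fun b hb => ?_)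
    refine ENNReal.le_of_forall_pos_le_add fun ε hε _ => ?_
    obtain ⟨x, hx, y, hxy, hy⟩ := h.exists_near hb (ENNReal.coe_pos.2 hε)
    calc edist y₀ b ≤ edist y₀ y + edist y b := edist_triangle _ _ _
      _ ≤ (⨆ a ∈ msupport α, edist x₀ a) + C + ε := by
        gcongr
        refine (hy₀ _ _ hxy).trans ?_
        gcongr
        exact le_iSup₂ (f := fun a (_ : a ∈ msupport α) => edist x₀ a) x hx
  · rw [ENNReal.iInf_add]
    refine le_iInf fun x₀ => ?_
    obtain ⟨y₀, hy₀⟩ := hC x₀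
    refine (iInf_le _ y₀).trans ?_
    obtain ⟨μ, rfl, rfl, hR⟩ := h
    have : IsProbabilityMeasure μ := isProbabilityMeasure_of_map
    have hq : 1 ≤ p.toReal := by
      simpa using ENNReal.toReal_mono hp' hp
    rw [lintegral_map (by fun_prop) measurable_fst, lintegral_map (by fun_prop) measurable_snd]
    refine le_trans ?_ (lintegral_rpow_add_const_le μ (f := fun z => edist x₀ z.1)
      (by fun_prop) hq C)
    gcongr ?_ ^ _
    refine lintegral_mono_ae ?_
    filter_upwards [hR] with z hz
    gcongr
    exact hy₀ _ _ hz

end Comparison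

section Finiteness

variable [PseudoEMetricSpace X] [MeasurableSpace X]

lemma pDiam_le_ediam {p : ℝ≥0∞} (hp : 1 ≤ p) (α : Measure X) [IsProbabilityMeasure α] :
    pDiam p α ≤ Metric.ediam (Set.univ : Set X) := by
  unfold pDiam
  split_ifs with hp'
  · exact Metric.ediam_mono (Set.subset_univ _)
  · have hq : 0 < p.toReal := ENNReal.toReal_pos (by positivity) hp'
    calc _ ≤ (∫⁻ _ : X, ∫⁻ _ : X,
            Metric.ediam (Set.univ : Set X) ^ p.toReal ∂α ∂α) ^ (1 / p.toReal) := by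
          gcongr
          exact Metric.edist_le_ediam_of_mem (Set.mem_univ _) (Set.mem_univ _)
      _ = _ := by simp [← ENNReal.rpow_mul, hq.ne']

lemma pRad_le_ediam {p : ℝ≥0∞} (hp : 1 ≤ p) (α : Measure X) [IsProbabilityMeasure α] :
    pRad p α ≤ Metric.ediam (Set.univ : Set X) := by
  obtain ⟨x⟩ : Nonempty X := nonempty_of_isProbabilityMeasure α
  unfold pRad
  split_ifs with hp'
  · exact (iInf_le _ x).trans (iSup₂_le fun a _ =>
      Metric.edist_le_ediam_of_mem (Set.mem_univ _) (Set.mem_univ _))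
  · have hq : 0 < p.toReal := ENNReal.toReal_pos (by positivity) hp'
    refine (iInf_le _ x).trans ?_
    calc _ ≤ (∫⁻ _ : X, Metric.ediam (Set.univ : Set X) ^ p.toReal ∂α) ^ (1 / p.toReal) := by
          gcongr
          exact Metric.edist_le_ediam_of_mem (Set.mem_univ _) (Set.mem_univ _)
      _ = _ := by simp [← ENNReal.rpow_mul, hq.ne']

end Finiteness

section Lincomb

lemma IsCoupledBy.lincomb [MeasurableSpace X] {α β γ : ProbabilityMeasure X}
    {R : X → X → Prop} (h₁ : IsCoupledBy α.toMeasure β.toMeasure R)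
    (h₂ : IsCoupledBy α.toMeasure γ.toMeasure R) {t : ℝ} (h0 : 0 ≤ t) (h1 : t ≤ 1) :
    IsCoupledBy α.toMeasure (lincomb t h0 h1 β γ).toMeasure R := by
  obtain ⟨μ, hμ₁, hμ₂, hμ⟩ := h₁
  obtain ⟨ν, hν₁, hν₂, hν⟩ := h₂
  refine ⟨ENNReal.ofReal (1 - t) • μ + ENNReal.ofReal t • ν, ?_, ?_, ?_⟩
  · rw [Measure.map_add _ _ measurable_fst, Measure.map_smul, Measure.map_smul, hμ₁, hν₁,
      ← add_smul, ← ENNReal.ofReal_add (by linarith) h0]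
    simp
  · rw [Measure.map_add _ _ measurable_snd, Measure.map_smul, Measure.map_smul, hμ₂, hν₂]
    rfl
  · rw [ae_add_measure_iff]
    exact ⟨Measure.ae_smul_measure hμ _, Measure.ae_smul_measure hν _⟩

lemma isCoupledBy_refl [MetricSpace X] [MeasurableSpace X] [BorelSpace X]
    [SecondCountableTopology X] (α : Measure X) {R : X → X → Prop} (hR : ∀ x, R x x) :
    IsCoupledBy α α R := by
  have hm : Measurable fun x : X => (x, x) := measurable_id.prodMk measurable_id
  refine ⟨α.map fun x => (x, x), ?_, ?_, ?_⟩
  · rw [Measure.map_map measurable_fst hm]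
    exact Measure.map_id
  · rw [Measure.map_map measurable_snd hm]
    exact Measure.map_id
  · have : ∀ᵐ z ∂(α.map fun x => (x, x)), z.1 = z.2 :=
      (ae_map_iff hm.aemeasurable (measurableSet_eq_fun measurable_fst measurable_snd)).2
        (by simp)
    filter_upwards [this] with z hz
    rw [← hz]
    exact hR _

lemma continuous_lincomb [TopologicalSpace X] [MeasurableSpace X] [OpensMeasurableSpace X]
    {A : Type*} [TopologicalSpace A] {f g : A → ProbabilityMeasure X} (hf : Continuous f)
    (hg : Continuous g) :
    Continuous fun z : A × unitInterval =>
      lincomb (z.2 : ℝ) z.2.2.1 z.2.2.2 (f z.1) (g z.1) := by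
  rw [ProbabilityMeasure.continuous_iff_forall_continuous_lintegral]
  intro φ
  have key : ∀ z : A × unitInterval,
      ∫⁻ x, φ x ∂(lincomb (z.2 : ℝ) z.2.2.1 z.2.2.2 (f z.1) (g z.1)).toMeasure
        = ENNReal.ofReal (1 - z.2) * ∫⁻ x, φ x ∂(f z.1).toMeasure
          + ENNReal.ofReal z.2 * ∫⁻ x, φ x ∂(g z.1).toMeasure := by
    intro z
    change ∫⁻ x, φ x ∂(ENNReal.ofReal (1 - z.2) • (f z.1).toMeasure
      + ENNReal.ofReal z.2 • (g z.1).toMeasure) = _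
    rw [lintegral_add_measure, lintegral_smul_measure, lintegral_smul_measure]
    rfl
  have main : ∀ (h : A → ProbabilityMeasure X) (c : unitInterval → ℝ), Continuous h →
      Continuous c → Continuous fun z : A × unitInterval =>
        ENNReal.ofReal (c z.2) * ∫⁻ x, φ x ∂(h z.1).toMeasure := by
    intro h c hh hc
    have h1 := ProbabilityMeasure.continuous_iff_forall_continuous_lintegral.1 hh φ
    refine continuous_iff_continuousAt.2 fun z => ENNReal.Tendsto.mul ?_ (Or.inr ?_) ?_
      (Or.inr ENNReal.ofReal_ne_top)
    · exact (ENNReal.continuous_ofReal.comp (hc.comp continuous_snd)).continuousAt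
    · exact (φ.lintegral_lt_top_of_nnreal _).ne
    · exact (h1.comp continuous_fst).continuousAt
  simp_rw [key]
  exact (main f (fun t => 1 - t) hf (by fun_prop)).add (main g (fun t => t) hg (by fun_prop))

lemma lincomb_zero [MeasurableSpace X] (α β : ProbabilityMeasure X) (h0 : (0 : ℝ) ≤ 0)
    (h1 : (0 : ℝ) ≤ 1) : lincomb 0 h0 h1 α β = α := by
  apply Subtype.ext
  simp [lincomb]

lemma lincomb_one [MeasurableSpace X] (α β : ProbabilityMeasure X) (h0 : (0 : ℝ) ≤ 1)
    (h1 : (1 : ℝ) ≤ 1) : lincomb 1 h0 h1 α β = β := by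
  apply Subtype.ext
  simp [lincomb]

lemma lincomb_mem_finPM [TopologicalSpace X] [MeasurableSpace X] {α β : ProbabilityMeasure X}
    (hα : α ∈ finPM X) (hβ : β ∈ finPM X) (t : ℝ) (h0 : 0 ≤ t) (h1 : t ≤ 1) :
    lincomb t h0 h1 α β ∈ finPM X :=
  (Set.Finite.union hα hβ).subset (msupport_smul_add_subset _ _ _ _)

end Lincomb

section Discretize

variable [MetricSpace X] [MeasurableSpace X] [BorelSpace X]
  [MetricSpace Y] [MeasurableSpace Y] [BorelSpace Y] {K : Type*} [Fintype K]

/-- Push a probability measure to the atoms `z k`, with weights the integrals of the functions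
`θ k` of a finite partition of unity. -/
def discretize (θ : K → C(X, ℝ≥0)) (hθ : ∀ x, ∑ k, θ k x = 1) (z : K → Y)
    (α : ProbabilityMeasure X) : ProbabilityMeasure Y :=
  ⟨∑ k, (∫⁻ x, θ k x ∂α.toMeasure) • Measure.dirac (z k), by
    constructor
    simp only [Measure.coe_finsetSum, Finset.sum_apply, Measure.smul_apply, measure_univ,
      smul_eq_mul, mul_one]
    rw [← lintegral_finsetSum _ fun k _ => (θ k).continuous.measurable.coe_nnreal_ennreal]
    simp [← ENNReal.ofNNReal_finsetSum, hθ]⟩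

variable (θ : K → C(X, ℝ≥0)) (hθ : ∀ x, ∑ k, θ k x = 1) (z : K → Y)

lemma discretize_mem_finPM (α : ProbabilityMeasure X) : discretize θ hθ z α ∈ finPM Y := by
  refine (Set.finite_range z).subset fun y hy => ?_
  by_contra hcon
  have h := hy (Set.range z)ᶜ (Set.finite_range z).isClosed.isOpen_compl hcon
  refine h.ne' ?_
  change (∑ k, (∫⁻ x, θ k x ∂α.toMeasure) • Measure.dirac (z k)) (Set.range z)ᶜ = 0
  simp only [Measure.coe_finsetSum, Finset.sum_apply, Measure.smul_apply, smul_eq_mul]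
  refine Finset.sum_eq_zero fun k _ => ?_
  rw [Measure.dirac_apply' _ (Set.finite_range z).isClosed.isOpen_compl.measurableSet]
  simp

lemma continuous_discretize : Continuous (discretize θ hθ z) := by
  rw [ProbabilityMeasure.continuous_iff_forall_continuous_lintegral]
  intro φ
  have key : ∀ α : ProbabilityMeasure X, ∫⁻ y, φ y ∂(discretize θ hθ z α).toMeasure
      = ∑ k, (∫⁻ x, θ k x ∂α.toMeasure) * φ (z k) := by
    intro α
    change ∫⁻ y, φ y ∂(∑ k, (∫⁻ x, θ k x ∂α.toMeasure) • Measure.dirac (z k)) = _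
    rw [lintegral_finsetSum_measure]
    refine Finset.sum_congr rfl fun k _ => ?_
    rw [lintegral_smul_measure, lintegral_dirac' _ φ.continuous.measurable.coe_nnreal_ennreal]
    rfl
  simp_rw [key]
  refine continuous_finsetSum _ fun k _ => ENNReal.continuous_mul_const ENNReal.coe_ne_top
    |>.comp ?_
  have hle : ∀ x, θ k x ≤ 1 := fun x =>
    hθ x ▸ Finset.single_le_sum (f := fun k => θ k x) (fun _ _ => zero_le) (Finset.mem_univ k)
  have hb : ∀ x y, dist (θ k x) (θ k y) ≤ 1 := fun x y => by
    have h1 : ((θ k x : ℝ≥0) : ℝ) ≤ 1 := hle x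
    have h2 : ((θ k y : ℝ≥0) : ℝ) ≤ 1 := hle y
    rw [NNReal.dist_eq, abs_le]
    constructor <;> linarith [(θ k x).coe_nonneg, (θ k y).coe_nonneg]
  exact ProbabilityMeasure.continuous_iff_forall_continuous_lintegral.1 continuous_id
    (BoundedContinuousFunction.mkOfBound (θ k) 1 hb)

lemma IsCoupledBy.discretize {W : Type*} [MeasurableSpace W] {α : Measure W}
    {β : ProbabilityMeasure X} {R : W → X → Prop} (h : IsCoupledBy α β.toMeasure R)
    {R' : W → Y → Prop} (hR' : ∀ y, MeasurableSet {w | R' w y})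
    (hRR : ∀ w x k, R w x → θ k x ≠ 0 → R' w (z k)) :
    IsCoupledBy α (discretize θ hθ z β).toMeasure R' := by
  obtain ⟨μ, rfl, hμ, hR⟩ := h
  have hm : ∀ k, Measurable fun w : W × X => (θ k w.2 : ℝ≥0∞) := fun k =>
    ((θ k).continuous.measurable.comp measurable_snd).coe_nnreal_ennreal
  have hz : ∀ k, Measurable fun w : W × X => (w.1, z k) := fun k => by fun_prop
  have hsum : ∑ k, μ.withDensity (fun w => (θ k w.2 : ℝ≥0∞)) = μ := by
    ext s hs
    simp only [Measure.coe_finsetSum, Finset.sum_apply, withDensity_apply _ hs]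
    rw [← lintegral_finsetSum _ fun k _ => hm k]
    simp [← ENNReal.ofNNReal_finsetSum, hθ]
  refine ⟨∑ k, (μ.withDensity fun w => (θ k w.2 : ℝ≥0∞)).map fun w => (w.1, z k), ?_, ?_, ?_⟩
  · rw [Measure.map_finset_sum measurable_fst.aemeasurable]
    conv_rhs => rw [← hsum, Measure.map_finset_sum measurable_fst.aemeasurable]
    refine Finset.sum_congr rfl fun k _ => ?_
    rw [Measure.map_map measurable_fst (hz k)]
    rfl
  · rw [Measure.map_finset_sum measurable_snd.aemeasurable]
    refine Finset.sum_congr rfl fun k _ => ?_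
    rw [Measure.map_map measurable_snd (hz k), ← hμ,
      lintegral_map (θ k).continuous.measurable.coe_nnreal_ennreal measurable_snd]
    have : (Prod.snd ∘ fun w : W × X => (w.1, z k)) = fun _ => z k := rfl
    rw [this, Measure.map_const, withDensity_apply _ MeasurableSet.univ, Measure.restrict_univ]
  · rw [ae_finsetSum_measure_iff]
    intro k _
    have hR'k : ∀ᵐ w ∂(μ.withDensity fun w => (θ k w.2 : ℝ≥0∞)), R' w.1 (z k) := by
      rw [ae_withDensity_iff (hm k)]
      filter_upwards [hR] with w hw hne
      exact hRR _ _ _ hw (by simpa using hne)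
    have hzk : ∀ᵐ w ∂((μ.withDensity fun w => (θ k w.2 : ℝ≥0∞)).map fun w => (w.1, z k)),
        w.2 = z k :=
      (ae_map_iff (hz k).aemeasurable (measurable_snd (measurableSet_singleton (z k)))).2
        (by simp)
    have hfst : ∀ᵐ w ∂((μ.withDensity fun w => (θ k w.2 : ℝ≥0∞)).map fun w => (w.1, z k)),
        R' w.1 (z k) :=
      (ae_map_iff (hz k).aemeasurable (measurable_fst (hR' (z k)))).2 hR'k
    filter_upwards [hzk, hfst] with w h1 h2
    rwa [h1]

end Discretize

section Partition

lemma exists_partition_of_unity [MetricSpace X] (hX : TotallyBounded (Set.univ : Set X))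
    {ε : ℝ≥0} (hε : 0 < ε) :
    ∃ (t : Finset X) (θ : t → C(X, ℝ≥0)), (∀ x, ∑ k, θ k x = 1) ∧
      ∀ k x, θ k x ≠ 0 → edist x (k : X) ≤ ε := by
  obtain ⟨s, hs, hcov⟩ := Metric.totallyBounded_iff.1 hX ε hε
  let t := hs.toFinset
  let w : t → X → ℝ≥0 := fun k x => ε - nndist x (k : X)
  have hw : ∀ k, Continuous (w k) := fun k => by fun_prop
  have hsum : Continuous fun x => ∑ k, w k x := continuous_finsetSum _ fun k _ => hw k
  have hpos : ∀ x, ∑ k, w k x ≠ 0 := by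
    intro x
    obtain ⟨y, hy, hxy⟩ := Set.mem_iUnion₂.1 (hcov (Set.mem_univ x))
    have hlt : nndist x y < ε := hxy
    have h1 : 0 < w ⟨y, hs.mem_toFinset.2 hy⟩ x := tsub_pos_of_lt hlt
    exact (h1.trans_le (Finset.single_le_sum (f := fun k => w k x) (fun _ _ => zero_le)
      (Finset.mem_univ _))).ne'
  refine ⟨t, fun k => ⟨fun x => w k x * (∑ j, w j x)⁻¹, (hw k).mul (hsum.inv₀ hpos)⟩, ?_, ?_⟩
  · intro x
    simp only [ContinuousMap.coe_mk]
    rw [← Finset.sum_mul, mul_inv_cancel₀ (hpos x)]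
  · intro k x hk
    have h1 : w k x ≠ 0 := left_ne_zero_of_mul hk
    have h2 : nndist x (k : X) < ε := tsub_pos_iff_lt.1 (pos_iff_ne_zero.2 h1)
    rw [edist_nndist]
    exact_mod_cast h2.le

end Partition

section Distortion

variable [MetricSpace X] [MetricSpace Y]

lemma edist_map_le_of_distortion_le {f : X → Y} {b : ℝ≥0∞} (h : distortion f ≤ b) (x x' : X) :
    edist (f x) (f x') ≤ edist x x' + b := by
  have h1 := (le_max_right _ _).trans ((le_iSup₂ (f := fun x x' =>
    max (edist x x' - edist (f x) (f x')) (edist (f x) (f x') - edist x x')) x x').trans h)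
  rw [add_comm]
  exact tsub_le_iff_right.1 h1

lemma edist_le_of_codistortion_le {φ : X → Y} {ψ : Y → X} {b : ℝ≥0∞}
    (h : codistortion φ ψ ≤ b) (x : X) (y : Y) :
    edist x (ψ y) ≤ edist (φ x) y + b ∧ edist (φ x) y ≤ edist x (ψ y) + b := by
  have h1 := (le_iSup₂ (f := fun x y =>
    max (edist x (ψ y) - edist (φ x) y) (edist (φ x) y - edist x (ψ y))) x y).trans h
  rw [add_comm (edist (φ x) y), add_comm (edist x (ψ y))]
  exact ⟨tsub_le_iff_right.1 ((le_max_left _ _).trans h1),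
    tsub_le_iff_right.1 ((le_max_right _ _).trans h1)⟩

end Distortion

section Transport

variable [MetricSpace X] [MeasurableSpace X] [BorelSpace X] [SecondCountableTopology X]
  [MetricSpace Y] [MeasurableSpace Y] [BorelSpace Y]

open Classical in
lemma isCoupledBy_discretize {t : Finset X} {θ : t → C(X, ℝ≥0)} (hθ : ∀ x, ∑ k, θ k x = 1)
    {ε : ℝ≥0∞} (hε : ∀ k x, θ k x ≠ 0 → edist x (k : X) ≤ ε) (φ : X → Y)
    (α : ProbabilityMeasure X) :
    IsCoupledBy α.toMeasure (discretize θ hθ (fun k => φ k) α).toMeasure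
      (fun x y => ∃ x', y = φ x' ∧ x' ∈ t ∧ edist x x' ≤ ε) := by
  refine (isCoupledBy_refl (R := fun x x' => x = x') α.toMeasure fun x => rfl).discretize
    θ hθ _ ?_ ?_
  · intro y
    have : {x | ∃ x', y = φ x' ∧ x' ∈ t ∧ edist x x' ≤ ε}
        = ⋃ x' ∈ t.filter (fun x' => y = φ x'), Metric.closedEBall x' ε := by
      ext x
      simp only [Set.mem_iUnion, Finset.mem_filter, Metric.mem_closedEBall]
      constructor
      · rintro ⟨x', h1, h2, h3⟩
        exact ⟨x', ⟨h2, h1⟩, h3⟩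
      · rintro ⟨x', ⟨h2, h1⟩, h3⟩
        exact ⟨x', h1, h2, h3⟩
    rw [this]
    exact Finset.measurableSet_biUnion _ fun x' _ => Metric.isClosed_closedEBall.measurableSet
  · rintro x _ k rfl hk
    exact ⟨k, rfl, k.2, hε k x hk⟩

lemma isCoupledBy_discretize_discretize {t : Finset X} {θ : t → C(X, ℝ≥0)}
    (hθ : ∀ x, ∑ k, θ k x = 1) {s : Finset Y} {ξ : s → C(Y, ℝ≥0)} (hξ : ∀ y, ∑ k, ξ k y = 1)
    {ε b : ℝ≥0∞} (hε : ∀ k x, θ k x ≠ 0 → edist x (k : X) ≤ ε)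
    (hε' : ∀ k y, ξ k y ≠ 0 → edist y (k : Y) ≤ ε) {φ : X → Y} {ψ : Y → X}
    (hb : ∀ x y, edist x (ψ y) ≤ edist (φ x) y + b) (α : ProbabilityMeasure X) :
    IsCoupledBy α.toMeasure
      (discretize ξ hξ (fun k => ψ k) (discretize θ hθ (fun k => φ k) α)).toMeasure
      (fun x x' => edist x x' ≤ b + 2 * ε) := by
  refine (isCoupledBy_discretize hθ hε φ α).discretize ξ hξ _ ?_ ?_
  · exact fun y => Metric.isClosed_closedEBall.measurableSet
  · rintro x _ k ⟨x', rfl, -, hx'⟩ hk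
    calc edist x (ψ k) ≤ edist x x' + edist x' (ψ k) := edist_triangle _ _ _
      _ ≤ ε + (ε + b) := by
        gcongr
        refine (hb _ _).trans ?_
        gcongr
        exact hε' _ _ hk
      _ = b + 2 * ε := by ring

lemma pDiam_discretize_le [SecondCountableTopology Y] {t : Finset X} {θ : t → C(X, ℝ≥0)}
    (hθ : ∀ x, ∑ k, θ k x = 1)
    {ε b : ℝ≥0∞} (hε : ∀ k x, θ k x ≠ 0 → edist x (k : X) ≤ ε) {φ : X → Y}
    (hb : ∀ x x', edist (φ x) (φ x') ≤ edist x x' + b) {p : ℝ≥0∞} (hp : 1 ≤ p)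
    (α : ProbabilityMeasure X) :
    pDiam p (discretize θ hθ (fun k => φ k) α).toMeasure ≤ pDiam p α.toMeasure + (b + 2 * ε) := by
  refine (isCoupledBy_discretize hθ hε φ α).pDiam_le hp ?_
  rintro x _ x' _ ⟨z, rfl, -, hz⟩ ⟨z', rfl, -, hz'⟩
  calc edist (φ z) (φ z') ≤ edist z z' + b := hb _ _
    _ ≤ (edist z x + edist x x' + edist x' z') + b := by gcongr; exact edist_triangle4 _ _ _ _
    _ ≤ (ε + edist x x' + ε) + b := by gcongr; rwa [edist_comm]
    _ = _ := by ring

lemma pRad_discretize_le {t : Finset X} {θ : t → C(X, ℝ≥0)} (hθ : ∀ x, ∑ k, θ k x = 1)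
    {ε b : ℝ≥0∞} (hε : ∀ k x, θ k x ≠ 0 → edist x (k : X) ≤ ε) {φ : X → Y}
    (hb : ∀ x x', edist (φ x) (φ x') ≤ edist x x' + b) {p : ℝ≥0∞} (hp : 1 ≤ p)
    (α : ProbabilityMeasure X) :
    pRad p (discretize θ hθ (fun k => φ k) α).toMeasure ≤ pRad p α.toMeasure + (b + 2 * ε) := by
  refine (isCoupledBy_discretize hθ hε φ α).pRad_le hp fun x₀ => ⟨φ x₀, ?_⟩
  rintro x _ ⟨z, rfl, -, hz⟩
  calc edist (φ x₀) (φ z) ≤ edist x₀ z + b := hb _ _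
    _ ≤ (edist x₀ x + edist x z) + b := by gcongr; exact edist_triangle _ _ _
    _ ≤ (edist x₀ x + 2 * ε) + b := by
      gcongr
      exact hz.trans (le_mul_of_one_le_left zero_le one_le_two)
    _ = _ := by ring

lemma IsCoupledBy.pDiam_lincomb_le {α β : ProbabilityMeasure X} {c : ℝ≥0∞}
    (h : IsCoupledBy α.toMeasure β.toMeasure fun x x' => edist x x' ≤ c) {p : ℝ≥0∞} (hp : 1 ≤ p)
    {t : ℝ} (h0 : 0 ≤ t) (h1 : t ≤ 1) :
    pDiam p (Paper.lincomb t h0 h1 β α).toMeasure ≤ pDiam p α.toMeasure + 2 * c := by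
  refine (h.lincomb (isCoupledBy_refl _ (by simp)) h0 h1).pDiam_le hp ?_
  intro x y x' y' hxy hxy'
  calc edist y y' ≤ edist y x + edist x x' + edist x' y' := edist_triangle4 _ _ _ _
    _ ≤ c + edist x x' + c := by gcongr; rwa [edist_comm]
    _ = _ := by ring

lemma IsCoupledBy.pRad_lincomb_le {α β : ProbabilityMeasure X} {c : ℝ≥0∞}
    (h : IsCoupledBy α.toMeasure β.toMeasure fun x x' => edist x x' ≤ c) {p : ℝ≥0∞} (hp : 1 ≤ p)
    {t : ℝ} (h0 : 0 ≤ t) (h1 : t ≤ 1) :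
    pRad p (Paper.lincomb t h0 h1 β α).toMeasure ≤ pRad p α.toMeasure + 2 * c := by
  refine (h.lincomb (isCoupledBy_refl _ (by simp)) h0 h1).pRad_le hp fun x₀ => ⟨x₀, ?_⟩
  intro x y hxy
  refine (edist_triangle _ x _).trans ?_
  gcongr
  exact hxy.trans (le_mul_of_one_le_left zero_le one_le_two)

end Transport

section Assembly

lemma toReal_le_toReal_add {a b : ℝ≥0∞} {c : ℝ≥0} (hb : b ≠ ∞) (h : a ≤ b + c) :
    a.toReal ≤ b.toReal + c := by
  have h1 := ENNReal.toReal_mono (ENNReal.add_ne_top.2 ⟨hb, ENNReal.coe_ne_top⟩) h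
  rwa [ENNReal.toReal_add hb ENNReal.coe_ne_top, ENNReal.coe_toReal] at h1

/-- `ι` identifies `A` with a convex space of probability measures containing the finitely
supported ones. -/
structure IsMeasureModel [TopologicalSpace X] [MeasurableSpace X] [OpensMeasurableSpace X]
    {A : Type*} [TopologicalSpace A] (ι : A → ProbabilityMeasure X) : Prop where
  isEmbedding : Topology.IsEmbedding ι
  finPM_subset : finPM X ⊆ Set.range ι
  lincomb_mem : ∀ α ∈ finPM X, ∀ a t h0 h1, lincomb t h0 h1 α (ι a) ∈ Set.range ι

lemma isMeasureModel_id [TopologicalSpace X] [MeasurableSpace X] [OpensMeasurableSpace X] :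
    IsMeasureModel (id : ProbabilityMeasure X → ProbabilityMeasure X) :=
  ⟨.id, by simp, by simp⟩

lemma isMeasureModel_val [TopologicalSpace X] [MeasurableSpace X] [OpensMeasurableSpace X] :
    IsMeasureModel (Subtype.val : ↥(finPM X) → ProbabilityMeasure X) :=
  ⟨.subtypeVal, by simp, fun _ hα a t h0 h1 => by
    simpa using lincomb_mem_finPM hα a.2 t h0 h1⟩

lemma IsMeasureModel.deltaHomotopic [TopologicalSpace X] [MeasurableSpace X]
    [OpensMeasurableSpace X] {A : Type*} [TopologicalSpace A] {ι : A → ProbabilityMeasure X}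
    (hι : IsMeasureModel ι) {S : A → A} (hS : Continuous S) (hfin : ∀ a, ι (S a) ∈ finPM X)
    {f : A → ℝ} {g : ProbabilityMeasure X → ℝ} (hf : ∀ a, f a = g (ι a)) {D : ℝ}
    (hg : ∀ a t h0 h1, g (lincomb t h0 h1 (ι (S a)) (ι a)) ≤ g (ι a) + D) :
    DeltaHomotopic f f D S id := by
  choose H hH using fun z : A × unitInterval =>
    hι.lincomb_mem _ (hfin z.1) z.1 (z.2 : ℝ) z.2.2.1 z.2.2.2
  have hcont : Continuous H := by
    rw [hι.isEmbedding.continuous_iff]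
    exact (continuous_lincomb (hι.isEmbedding.continuous.comp hS)
      hι.isEmbedding.continuous).congr fun z => (hH z).symm
  refine ⟨H, hcont, fun a => ?_, fun a => ?_, fun t => ⟨?_, fun a => ?_⟩⟩
  · exact hι.isEmbedding.injective ((hH (a, 0)).trans (lincomb_zero _ _ _ _))
  · exact hι.isEmbedding.injective ((hH (a, 1)).trans (lincomb_one _ _ _ _))
  · exact hcont.comp (by fun_prop)
  · rw [hf, hf, hH]
    exact hg _ _ _ _

lemma deltaHomotopyEquiv_of_maps [TopologicalSpace X] [MeasurableSpace X] [OpensMeasurableSpace X]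
    [TopologicalSpace Y] [MeasurableSpace Y] [OpensMeasurableSpace Y]
    {F : ProbabilityMeasure X → ProbabilityMeasure Y}
    {G : ProbabilityMeasure Y → ProbabilityMeasure X} (hF : Continuous F) (hG : Continuous G)
    (hFfin : ∀ α, F α ∈ finPM Y) (hGfin : ∀ β, G β ∈ finPM X)
    {f : ProbabilityMeasure X → ℝ≥0∞} {g : ProbabilityMeasure Y → ℝ≥0∞} {c : ℝ≥0}
    (hf : ∀ α, f α ≠ ∞) (hg : ∀ β, g β ≠ ∞)
    (hFle : ∀ α, g (F α) ≤ f α + c) (hGle : ∀ β, f (G β) ≤ g β + c)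
    (hGF : ∀ α t h0 h1, f (lincomb t h0 h1 (G (F α)) α) ≤ f α + 2 * c)
    (hFG : ∀ β t h0 h1, g (lincomb t h0 h1 (F (G β)) β) ≤ g β + 2 * c)
    {A B : Type*} [TopologicalSpace A] [TopologicalSpace B] {ι : A → ProbabilityMeasure X}
    {κ : B → ProbabilityMeasure Y} (hι : IsMeasureModel ι) (hκ : IsMeasureModel κ) :
    DeltaHomotopyEquiv c (fun a => (f (ι a)).toReal) (fun b => (g (κ b)).toReal) := by
  choose F' hF' using fun a => hκ.finPM_subset (hFfin (ι a))
  choose G' hG' using fun b => hι.finPM_subset (hGfin (κ b))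
  have hF'c : Continuous F' := by
    rw [hκ.isEmbedding.continuous_iff]
    exact (hF.comp hι.isEmbedding.continuous).congr fun a => (hF' a).symm
  have hG'c : Continuous G' := by
    rw [hι.isEmbedding.continuous_iff]
    exact (hG.comp hκ.isEmbedding.continuous).congr fun b => (hG' b).symm
  have h2 : ((2 * c : ℝ≥0) : ℝ≥0∞) = 2 * c := by push_cast; rfl
  refine ⟨F', G', ⟨hF'c, fun a => ?_⟩, ⟨hG'c, fun b => ?_⟩, ?_, ?_⟩
  · beta_reduce
    rw [hF']
    exact toReal_le_toReal_add (hf _) (hFle _)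
  · beta_reduce
    rw [hG']
    exact toReal_le_toReal_add (hg _) (hGle _)
  · refine hι.deltaHomotopic (hG'c.comp hF'c) (fun a => ?_) (g := fun α => (f α).toReal)
      (fun a => rfl) fun a t h0 h1 => ?_
    · rw [Function.comp_apply, hG']
      exact hGfin _
    · rw [Function.comp_apply, hG', hF']
      exact_mod_cast toReal_le_toReal_add (c := 2 * c) (hf _) (h2 ▸ hGF _ _ _ _)
  · refine hκ.deltaHomotopic (hF'c.comp hG'c) (fun b => ?_) (g := fun β => (g β).toReal)
      (fun b => rfl) fun b t h0 h1 => ?_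
    · rw [Function.comp_apply, hF']
      exact hFfin _
    · rw [Function.comp_apply, hF', hG']
      exact_mod_cast toReal_le_toReal_add (c := 2 * c) (hg _) (h2 ▸ hFG _ _ _ _)

lemma dHT_le_of_deltaHomotopyEquiv {A B : Type*} [TopologicalSpace A] [TopologicalSpace B]
    {f : A → ℝ} {g : B → ℝ} {c : ℝ≥0} (h : DeltaHomotopyEquiv c f g) : dHT f g ≤ c :=
  sInf_le ⟨c, c.2, h, by simp⟩

lemma exists_maps_of_two_mul_ghDist_lt [MetricSpace X] [MetricSpace Y] {c : ℝ≥0∞}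
    (h : 2 * ghDist X Y < c) :
    ∃ (φ : X → Y) (ψ : Y → X), distortion φ ≤ c ∧ distortion ψ ≤ c ∧ codistortion φ ψ ≤ c := by
  rw [ghDist, one_div, ← mul_assoc, ENNReal.mul_inv_cancel two_ne_zero ENNReal.ofNat_ne_top,
    one_mul] at h
  simp only [iInf_lt_iff, max_lt_iff] at h
  obtain ⟨φ, ψ, h1, h2, h3⟩ := h
  exact ⟨φ, ψ, h1.le, h2.le, h3.le⟩

lemma secondCountableTopology_of_totallyBounded [MetricSpace X]
    (hX : TotallyBounded (Set.univ : Set X)) : SecondCountableTopology X := by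
  have := TopologicalSpace.isSeparable_univ_iff.1 hX.isSeparable
  exact UniformSpace.secondCountable_of_separable X

end Assembly

/-- For totally bounded metric spaces `X, Y` and `p ∈ [1,∞]`:
`d_HT((𝒫_X, diam_p), (𝒫_Y, diam_p)) ≤ 2·d_GH(X,Y)` and
`d_HT((𝒫_X, rad_p), (𝒫_Y, rad_p)) ≤ 2·d_GH(X,Y)`, and the same bounds hold on the
subspaces of finitely supported measures. -/
theorem dHT_diam_rad_le_ghDist (X Y : Type*)
    [MetricSpace X] [MeasurableSpace X] [BorelSpace X]
    [MetricSpace Y] [MeasurableSpace Y] [BorelSpace Y]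
    (p : ℝ≥0∞) (hp : 1 ≤ p)
    (hX : TotallyBounded (Set.univ : Set X)) (hY : TotallyBounded (Set.univ : Set Y)) :
    dHT (fun α : ProbabilityMeasure X => (pDiam p α.toMeasure).toReal)
        (fun β : ProbabilityMeasure Y => (pDiam p β.toMeasure).toReal)
      ≤ 2 * ghDist X Y ∧
    dHT (fun α : ProbabilityMeasure X => (pRad p α.toMeasure).toReal)
        (fun β : ProbabilityMeasure Y => (pRad p β.toMeasure).toReal)
      ≤ 2 * ghDist X Y ∧
    dHT (fun α : ↥(finPM X) => (pDiam p (α : ProbabilityMeasure X).toMeasure).toReal)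
        (fun β : ↥(finPM Y) => (pDiam p (β : ProbabilityMeasure Y).toMeasure).toReal)
      ≤ 2 * ghDist X Y ∧
    dHT (fun α : ↥(finPM X) => (pRad p (α : ProbabilityMeasure X).toMeasure).toReal)
        (fun β : ↥(finPM Y) => (pRad p (β : ProbabilityMeasure Y).toMeasure).toReal)
      ≤ 2 * ghDist X Y := by
  have := secondCountableTopology_of_totallyBounded hX
  have := secondCountableTopology_of_totallyBounded hY
  have hXtop : Metric.ediam (Set.univ : Set X) ≠ ∞ := hX.isBounded.ediam_ne_top
  have hYtop : Metric.ediam (Set.univ : Set Y) ≠ ∞ := hY.isBounded.ediam_ne_top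
  suffices H : ∀ c : ℝ≥0, 2 * ghDist X Y < c →
      ∃ (F : ProbabilityMeasure X → ProbabilityMeasure Y)
        (G : ProbabilityMeasure Y → ProbabilityMeasure X),
        Continuous F ∧ Continuous G ∧ (∀ α, F α ∈ finPM Y) ∧ (∀ β, G β ∈ finPM X) ∧
        (∀ α, pDiam p (F α).toMeasure ≤ pDiam p α.toMeasure + c ∧
          pRad p (F α).toMeasure ≤ pRad p α.toMeasure + c) ∧
        (∀ β, pDiam p (G β).toMeasure ≤ pDiam p β.toMeasure + c ∧
          pRad p (G β).toMeasure ≤ pRad p β.toMeasure + c) ∧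
        (∀ α, IsCoupledBy α.toMeasure (G (F α)).toMeasure fun x x' => edist x x' ≤ c) ∧
        (∀ β, IsCoupledBy β.toMeasure (F (G β)).toMeasure fun y y' => edist y y' ≤ c) by
    have hdiam : ∀ {A B : Type _} [TopologicalSpace A] [TopologicalSpace B]
        {ι : A → ProbabilityMeasure X} {κ : B → ProbabilityMeasure Y},
        IsMeasureModel ι → IsMeasureModel κ →
        dHT (fun a => (pDiam p (ι a).toMeasure).toReal)
          (fun b => (pDiam p (κ b).toMeasure).toReal) ≤ 2 * ghDist X Y := by
      intro A B _ _ ι κ hι hκ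
      refine le_of_forall_gt_imp_ge_of_dense fun d hd => ?_
      obtain ⟨c, hc, hcd⟩ := ENNReal.lt_iff_exists_nnreal_btwn.1 hd
      refine le_trans ?_ hcd.le
      obtain ⟨F, G, hF, hG, hFfin, hGfin, hFle, hGle, hGF, hFG⟩ := H c hc
      exact dHT_le_of_deltaHomotopyEquiv (deltaHomotopyEquiv_of_maps hF hG hFfin hGfin
        (f := fun α => pDiam p α.toMeasure) (g := fun β => pDiam p β.toMeasure)
        (fun α => ne_top_of_le_ne_top hXtop (pDiam_le_ediam hp _))
        (fun β => ne_top_of_le_ne_top hYtop (pDiam_le_ediam hp _))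
        (fun α => (hFle α).1) (fun β => (hGle β).1)
        (fun α t h0 h1 => (hGF α).pDiam_lincomb_le hp h0 h1)
        (fun β t h0 h1 => (hFG β).pDiam_lincomb_le hp h0 h1) hι hκ)
    have hrad : ∀ {A B : Type _} [TopologicalSpace A] [TopologicalSpace B]
        {ι : A → ProbabilityMeasure X} {κ : B → ProbabilityMeasure Y},
        IsMeasureModel ι → IsMeasureModel κ →
        dHT (fun a => (pRad p (ι a).toMeasure).toReal)
          (fun b => (pRad p (κ b).toMeasure).toReal) ≤ 2 * ghDist X Y := by
      intro A B _ _ ι κ hι hκ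
      refine le_of_forall_gt_imp_ge_of_dense fun d hd => ?_
      obtain ⟨c, hc, hcd⟩ := ENNReal.lt_iff_exists_nnreal_btwn.1 hd
      refine le_trans ?_ hcd.le
      obtain ⟨F, G, hF, hG, hFfin, hGfin, hFle, hGle, hGF, hFG⟩ := H c hc
      exact dHT_le_of_deltaHomotopyEquiv (deltaHomotopyEquiv_of_maps hF hG hFfin hGfin
        (f := fun α => pRad p α.toMeasure) (g := fun β => pRad p β.toMeasure)
        (fun α => ne_top_of_le_ne_top hXtop (pRad_le_ediam hp _))
        (fun β => ne_top_of_le_ne_top hYtop (pRad_le_ediam hp _))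
        (fun α => (hFle α).2) (fun β => (hGle β).2)
        (fun α t h0 h1 => (hGF α).pRad_lincomb_le hp h0 h1)
        (fun β t h0 h1 => (hFG β).pRad_lincomb_le hp h0 h1) hι hκ)
    exact ⟨hdiam isMeasureModel_id isMeasureModel_id, hrad isMeasureModel_id isMeasureModel_id,
      hdiam isMeasureModel_val isMeasureModel_val, hrad isMeasureModel_val isMeasureModel_val⟩
  intro c hc
  obtain ⟨b, hb, hbc⟩ := ENNReal.lt_iff_exists_nnreal_btwn.1 hc
  have hbc' : b < c := by exact_mod_cast hbc
  obtain ⟨φ, ψ, hφ, hψ, hφψ⟩ := exists_maps_of_two_mul_ghDist_lt hb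
  have hε : 0 < (c - b) / 2 := half_pos (tsub_pos_of_lt hbc')
  have hcε : (c : ℝ≥0∞) = b + 2 * ((c - b) / 2 : ℝ≥0) := by
    norm_cast
    rw [mul_div_cancel₀ _ two_ne_zero, add_tsub_cancel_of_le hbc'.le]
  obtain ⟨t, θ, hθ, hθε⟩ := exists_partition_of_unity hX hε
  obtain ⟨s, ξ, hξ, hξε⟩ := exists_partition_of_unity hY hε
  refine ⟨discretize θ hθ fun k => φ k, discretize ξ hξ fun k => ψ k,
    continuous_discretize _ _ _, continuous_discretize _ _ _, discretize_mem_finPM _ _ _,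
    discretize_mem_finPM _ _ _, fun α => ?_, fun β => ?_, fun α => ?_, fun β => ?_⟩ <;>
  rw [hcε]
  · exact ⟨pDiam_discretize_le hθ hθε (edist_map_le_of_distortion_le hφ) hp α,
      pRad_discretize_le hθ hθε (edist_map_le_of_distortion_le hφ) hp α⟩
  · exact ⟨pDiam_discretize_le hξ hξε (edist_map_le_of_distortion_le hψ) hp β,
      pRad_discretize_le hξ hξε (edist_map_le_of_distortion_le hψ) hp β⟩
  · exact isCoupledBy_discretize_discretize hθ hξ hθε hξε
      (fun x y => (edist_le_of_codistortion_le hφψ x y).1) α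
  · refine isCoupledBy_discretize_discretize hξ hθ hξε hθε (fun y x => ?_) β
    rw [edist_comm y, edist_comm _ x]
    exact (edist_le_of_codistortion_le hφψ x y).2

end Paper
end
end
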